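/- Let D_1,…,D_q be hypersurfaces in ℂP^M in N-subgeneral position in a smooth projective variety V ⊂ ℂP^M of dimension n (N ≥ n, q ≥ N+1), with codimension function c on subsets of Q = {1,…,q}. If K ⊆ R ⊆ Q and #K = c(K), then there exists a set K' with K ⊆ K' ⊆ R and c(K') = #K' = c(R). -/

import Mathlib

open MvPolynomial Filter

noncomputable section

namespace SMT

/-- The affine cone in `ℂ^K` cut out by an ideal of polynomials
(the common zero set of all its members). -/
def coneOf {K : ℕ} (I : Ideal (MvPolynomial (Fin K) ℂ)) : Set (Fin K → ℂ) :=
  {x | ∀ Q ∈ I, MvPolynomial.eval x Q = 0}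

/-- The vanishing ideal of a subset of `ℂ^K`. -/
def vIdeal {K : ℕ} (A : Set (Fin K → ℂ)) : Ideal (MvPolynomial (Fin K) ℂ) where
  carrier := {Q | ∀ x ∈ A, MvPolynomial.eval x Q = 0}
  add_mem' := by
    intro a b ha hb x hx
    simp [ha x hx, hb x hx]
  zero_mem' := by
    intro x hx
    simp
  smul_mem' := by
    intro c p hp x hx
    simp [smul_eq_mul, hp x hx]

/-- The dimension of (the affine cone over) a subset of `ℂ^K`:
the Krull dimension of its coordinate ring, read off as a natural number. -/
def coneDim {K : ℕ} (A : Set (Fin K → ℂ)) : ℕ :=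
  ENat.toNat ((ringKrullDim (MvPolynomial (Fin K) ℂ ⧸ vIdeal A)).unbotD 0)

/-- `I` is the homogeneous (prime) ideal of a complex projective variety of dimension `n`
in `ℂP^{K-1}`: it is prime, generated by homogeneous polynomials, and the affine cone
has Krull dimension `n + 1`. -/
def IsVariety {K : ℕ} (n : ℕ) (I : Ideal (MvPolynomial (Fin K) ℂ)) : Prop :=
  I.IsPrime ∧
  (∃ S : Set (MvPolynomial (Fin K) ℂ), (∀ Q ∈ S, ∃ e, Q.IsHomogeneous e) ∧ I = Ideal.span S) ∧
  ringKrullDim (MvPolynomial (Fin K) ℂ ⧸ I) = (((n + 1 : ℕ) : ℕ∞) : WithBot ℕ∞)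

/-- A smooth complex projective variety of dimension `n` in `ℂP^{K-1}`, presented by its
homogeneous prime ideal: smoothness via the Jacobian criterion at every nonzero point of
the affine cone. -/
def IsSmoothVariety {K : ℕ} (n : ℕ) (I : Ideal (MvPolynomial (Fin K) ℂ)) : Prop :=
  IsVariety n I ∧
  ∀ x ∈ coneOf I, x ≠ 0 →
    Module.finrank ℂ (Submodule.span ℂ
      {v : Fin K → ℂ | ∃ Q ∈ I, v = fun i => MvPolynomial.eval x (MvPolynomial.pderiv i Q)})
      = K - 1 - n

/-- The affine cone over the hypersurface defined by a homogeneous polynomial. -/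
def hypCone {K : ℕ} (Q : MvPolynomial (Fin K) ℂ) : Set (Fin K → ℂ) :=
  {x | MvPolynomial.eval x Q = 0}

/-- The affine cone over `V ∩ (∩_{j ∈ R} D_j)`. -/
def interCone {K q : ℕ} (I : Ideal (MvPolynomial (Fin K) ℂ))
    (Q : Fin q → MvPolynomial (Fin K) ℂ) (R : Finset (Fin q)) : Set (Fin K → ℂ) :=
  coneOf I ∩ ⋂ j ∈ R, hypCone (Q j)

/-- The codimension function `c(R) = codim_V (V ∩ ∩_{j∈R} D_j)`, with `c(∅) = 0` and
the convention `codim ∅ = n+1` (the cone over the empty projective set is `{0}`,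
of cone dimension `0`). -/
def cdim {K q : ℕ} (n : ℕ) (I : Ideal (MvPolynomial (Fin K) ℂ))
    (Q : Fin q → MvPolynomial (Fin K) ℂ) (R : Finset (Fin q)) : ℕ :=
  n + 1 - coneDim (interCone I Q R)

/-- `ρ(R₁,R₂) = (c(R₂) - c(R₁)) / (#R₂ - #R₁)`. -/
def rho {K q : ℕ} (n : ℕ) (I : Ideal (MvPolynomial (Fin K) ℂ))
    (Q : Fin q → MvPolynomial (Fin K) ℂ) (R₁ R₂ : Finset (Fin q)) : ℝ :=
  ((cdim n I Q R₂ : ℝ) - (cdim n I Q R₁ : ℝ)) / ((R₂.card : ℝ) - (R₁.card : ℝ))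

/-- The hypersurfaces `D_j = {Q j = 0}`, `j ∈ S`, are in general position in the
projective variety `V` (of dimension `n`) defined by `I`: any `s` of them (`1 ≤ s ≤ n+1`)
can be complemented by `n+1-s` further hypersurfaces so that the total intersection with
`V` is empty (in projective space, i.e. the cones meet only in `0`). -/
def GenPos {K q : ℕ} (n : ℕ) (I : Ideal (MvPolynomial (Fin K) ℂ))
    (Q : Fin q → MvPolynomial (Fin K) ℂ) (S : Finset (Fin q)) : Prop :=
  ∀ J : Finset (Fin q), J ⊆ S → 1 ≤ J.card → J.card ≤ n + 1 →
    ∃ Q' : Fin (n + 1 - J.card) → MvPolynomial (Fin K) ℂ,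
      (∀ k, ∃ e, 1 ≤ e ∧ (Q' k).IsHomogeneous e) ∧
      ∀ x ∈ interCone I Q J, (∀ k, MvPolynomial.eval x (Q' k) = 0) → x = 0

/-- A set is algebraic if it is the zero set of its vanishing ideal. -/
def IsAlgSet {K : ℕ} (A : Set (Fin K → ℂ)) : Prop := A = coneOf (vIdeal A)

/-- `σ` is an irreducible component of `S`: an algebraic irreducible subset of `S`,
maximal among such. -/
def IsIrredComponent {K : ℕ} (σ S : Set (Fin K → ℂ)) : Prop :=
  σ ⊆ S ∧ IsAlgSet σ ∧ (vIdeal σ).IsPrime ∧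
  ∀ τ : Set (Fin K → ℂ), τ ⊆ S → IsAlgSet τ → (vIdeal τ).IsPrime → σ ⊆ τ → σ = τ

/-- Condition (i) of Definition 1.1: any `N+1` of the hypersurfaces meet `V` in the
empty (projective) set. -/
def SubgenI {K q : ℕ} (N : ℕ) (I : Ideal (MvPolynomial (Fin K) ℂ))
    (Q : Fin q → MvPolynomial (Fin K) ℂ) : Prop :=
  ∀ J : Finset (Fin q), J.card = N + 1 → ∀ x ∈ interCone I Q J, x = 0

/-- Condition (ii) of Definition 1.1. -/
def SubgenII {K q : ℕ} (n : ℕ) (I : Ideal (MvPolynomial (Fin K) ℂ))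
    (Q : Fin q → MvPolynomial (Fin K) ℂ) : Prop :=
  ∀ J : Finset (Fin q), 0 < J.card → J.card ≤ n + 1 → GenPos n I Q J →
    (∃ x ∈ interCone I Q J, x ≠ 0) →
    ∃ σ : Set (Fin K → ℂ), IsIrredComponent σ (interCone I Q J) ∧
      coneDim σ = coneDim (interCone I Q J) ∧
      ∀ i ∉ J, coneDim (interCone I Q (insert i J)) = coneDim (interCone I Q J) →
        σ ⊆ hypCone (Q i)

/-- The hypersurfaces `D_j = {Q j = 0}` are in `N`-subgeneral position in the projective
variety `V` defined by `I` (Definition 1.1), including the requirement `V ⊄ D_j`. -/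
def InSubgenPos {K q : ℕ} (n N : ℕ) (I : Ideal (MvPolynomial (Fin K) ℂ))
    (Q : Fin q → MvPolynomial (Fin K) ℂ) : Prop :=
  (∀ j, ¬ (coneOf I ⊆ hypCone (Q j))) ∧ SubgenI N I Q ∧ SubgenII n I Q

/-- The Hilbert function `H_X(m) = dim_ℂ ℂ[x]_m / I(m)` of (the variety with homogeneous
ideal) `I`. -/
def hilbert {K : ℕ} (I : Ideal (MvPolynomial (Fin K) ℂ)) (m : ℕ) : ℕ :=
  Module.finrank ℂ
    ((MvPolynomial.homogeneousSubmodule (Fin K) ℂ m) ⧸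
      (Submodule.comap (MvPolynomial.homogeneousSubmodule (Fin K) ℂ m).subtype
        (Submodule.restrictScalars ℂ I)))

/-- The degree of an `n`-dimensional projective variety with homogeneous ideal `I`:
the (unique) natural number `Δ` with `H(m) = Δ·mⁿ/n! + O(m^{n-1})`. -/
def pdeg {K : ℕ} (n : ℕ) (I : Ideal (MvPolynomial (Fin K) ℂ)) : ℕ :=
  sInf {Δ : ℕ | Filter.Tendsto
    (fun m : ℕ => (hilbert I m : ℝ) * (n.factorial : ℝ) / (m : ℝ) ^ n)
    Filter.atTop (nhds (Δ : ℝ))}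

/-- The image cone of the cone of `I` under `x ↦ (Q_1(x), …, Q_q(x))`. -/
def imgCone {K q : ℕ} (I : Ideal (MvPolynomial (Fin K) ℂ))
    (Q : Fin q → MvPolynomial (Fin K) ℂ) : Set (Fin q → ℂ) :=
  (fun x j => MvPolynomial.eval x (Q j)) '' coneOf I

/-! Nevanlinna-theoretic notions. -/

/-- `‖f(z)‖ = max_i |f_i(z)|` for a tuple of functions. -/
def projNorm {ι : Type*} [Fintype ι] (f : ι → ℂ → ℂ) (z : ℂ) : ℝ :=
  ⨆ i, ‖f i z‖

/-- The Nevanlinna characteristic function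
`T_f(r) = (2π)⁻¹ ∫_0^{2π} log ‖f(re^{iθ})‖ dθ`. -/
def charFn {ι : Type*} [Fintype ι] (f : ι → ℂ → ℂ) (r : ℝ) : ℝ :=
  (2 * Real.pi)⁻¹ *
    ∫ θ in (0:ℝ)..(2 * Real.pi),
      Real.log (projNorm f ((r : ℂ) * Complex.exp ((θ : ℂ) * Complex.I)))

/-- The vanishing order of an entire function at a point (the zero divisor). -/
def zeroOrder (φ : ℂ → ℂ) (z : ℂ) : ℕ :=
  sInf {k : ℕ | iteratedDeriv k φ z ≠ 0}

/-- The (unintegrated) counting function `N_φ(r)` of the zero divisor of `φ`. -/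
def count (φ : ℂ → ℂ) (r : ℝ) : ℝ :=
  ∫ t in (1:ℝ)..r, (∑ᶠ z ∈ {z : ℂ | ‖z‖ < t}, ((zeroOrder φ z : ℕ) : ℝ)) / t

/-- The counting function truncated at level `L`. -/
def countTrunc (L : ℕ) (φ : ℂ → ℂ) (r : ℝ) : ℝ :=
  ∫ t in (1:ℝ)..r,
    (∑ᶠ z ∈ {z : ℂ | ‖z‖ < t}, ((min (zeroOrder φ z) L : ℕ) : ℝ)) / t

/-- A tuple of entire functions without common zeros (a reduced representation of a
holomorphic curve in projective space). -/
def ReducedRepr {ι : Type*} [Fintype ι] (f : ι → ℂ → ℂ) : Prop :=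
  (∀ i, Differentiable ℂ (f i)) ∧ ∀ z, ∃ i, f i z ≠ 0

/-- The entire function `Q(f_0, …, f_{K-1})`. -/
def polyComp {K : ℕ} (Q : MvPolynomial (Fin K) ℂ) (f : Fin K → ℂ → ℂ) : ℂ → ℂ :=
  fun z => MvPolynomial.eval (fun i => f i z) Q

/-- The curve with reduced representation `f` has image inside the variety of `I`. -/
def MapsIntoCone {K : ℕ} (f : Fin K → ℂ → ℂ) (I : Ideal (MvPolynomial (Fin K) ℂ)) : Prop :=
  ∀ z, (fun i => f i z) ∈ coneOf I

/-- `f` is an algebraically nondegenerate holomorphic map into the variety of `I`: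
its image is contained in `V` but in no proper algebraic subvariety of `V`. -/
def AlgNondeg {K : ℕ} (f : Fin K → ℂ → ℂ) (I : Ideal (MvPolynomial (Fin K) ℂ)) : Prop :=
  MapsIntoCone f I ∧
  ∀ P : MvPolynomial (Fin K) ℂ, (∃ e, P.IsHomogeneous e) → P ∉ I →
    ∃ z, polyComp P f z ≠ 0

/-- `P r` holds for all `r ∈ [1,∞)` outside a Borel subset `E` of `(1,∞)` of finite
Lebesgue measure. -/
def ExcSMT (P : ℝ → Prop) : Prop :=
  ∃ E : Set ℝ, MeasurableSet E ∧ E ⊆ Set.Ioi 1 ∧ MeasureTheory.volume E < ⊤ ∧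
    ∀ r : ℝ, 1 ≤ r → r ∉ E → P r


def lineMap {K : ℕ} (x : Fin K → ℂ) : MvPolynomial (Fin K) ℂ →ₐ[ℂ] Polynomial ℂ :=
  MvPolynomial.aeval (fun i => Polynomial.C (x i) * Polynomial.X)

lemma eval_lineMap {K : ℕ} (x : Fin K → ℂ) (t : ℂ) (p : MvPolynomial (Fin K) ℂ) :
    Polynomial.eval t (lineMap x p) = MvPolynomial.eval (t • x) p := by
  induction p using MvPolynomial.induction_on with
  | C a => simp [lineMap]
  | add p q hp hq => simp [hp, hq]
  | mul_X p i hp => 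
    rw [map_mul, Polynomial.eval_mul, hp, map_mul]
    congr 1
    simp only [lineMap, MvPolynomial.aeval_X, Polynomial.eval_mul, Polynomial.eval_C,
      Polynomial.eval_X, MvPolynomial.eval_X, Pi.smul_apply, smul_eq_mul]
    ring

lemma lineMap_homog {K : ℕ} (x : Fin K → ℂ) {m : ℕ} {p : MvPolynomial (Fin K) ℂ}
    (hp : p.IsHomogeneous m) :
    lineMap x p = Polynomial.C (MvPolynomial.eval x p) * Polynomial.X ^ m := by
  rw [lineMap, MvPolynomial.aeval_def, MvPolynomial.eval₂_eq, MvPolynomial.eval_eq, map_sum,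
    Finset.sum_mul]
  refine Finset.sum_congr rfl fun s hs => ?_
  have h1 : s.degree = m := by
    have := hp (MvPolynomial.mem_support_iff.1 hs)
    rw [Finsupp.degree_eq_weight_one]; exact this
  have h2 : ∏ i ∈ s.support, (Polynomial.X : Polynomial ℂ) ^ (s i) = Polynomial.X ^ m := by
    rw [Finset.prod_pow_eq_pow_sum, ← h1]; rfl
  simp only [mul_pow, Finset.prod_mul_distrib, h2, map_mul, map_prod, map_pow]
  simp [mul_assoc]

lemma eval_smul_homog {K : ℕ} (x : Fin K → ℂ) (t : ℂ) {m : ℕ} {p : MvPolynomial (Fin K) ℂ}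
    (hp : p.IsHomogeneous m) :
    MvPolynomial.eval (t • x) p = MvPolynomial.eval x p * t ^ m := by
  rw [← eval_lineMap, lineMap_homog x hp]; simp

/-- stable under scaling -/
def IsCone {K : ℕ} (X : Set (Fin K → ℂ)) : Prop := ∀ (t : ℂ), ∀ x ∈ X, t • x ∈ X

lemma lineMap_eq_zero {K : ℕ} {X : Set (Fin K → ℂ)} (hX : IsCone X) {x} (hx : x ∈ X)
    {p : MvPolynomial (Fin K) ℂ} (hp : p ∈ vIdeal X) : lineMap x p = 0 := by
  apply Polynomial.funext
  intro t
  rw [eval_lineMap, Polynomial.eval_zero]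
  exact hp _ (hX t x hx)

lemma vIdeal_homog {K : ℕ} {X : Set (Fin K → ℂ)} (hX : IsCone X)
    {p : MvPolynomial (Fin K) ℂ} (hp : p ∈ vIdeal X) (m : ℕ) :
    MvPolynomial.homogeneousComponent m p ∈ vIdeal X := by
  intro x hx
  have h := lineMap_eq_zero hX hx hp
  rw [← MvPolynomial.sum_homogeneousComponent p, map_sum] at h
  simp_rw [lineMap_homog x (MvPolynomial.homogeneousComponent_isHomogeneous _ p)] at h
  have h2 := congrArg (fun f => Polynomial.coeff f m) h
  simp only [Polynomial.finsetSum_coeff, Polynomial.coeff_C_mul, Polynomial.coeff_X_pow,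
    Polynomial.coeff_zero, mul_ite, mul_one, mul_zero, Finset.sum_ite_eq, Finset.mem_range] at h2
  by_cases hm : m < p.totalDegree + 1
  · simpa [hm] using h2
  · rw [MvPolynomial.homogeneousComponent_eq_zero _ _ (by omega)]; simp

lemma vIdeal_anti {K : ℕ} {X Y : Set (Fin K → ℂ)} (h : X ⊆ Y) : vIdeal Y ≤ vIdeal X :=
  fun _ hp x hx => hp x (h hx)

lemma vIdeal_ne_top {K : ℕ} {X : Set (Fin K → ℂ)} (h : X.Nonempty) : vIdeal X ≠ ⊤ := by
  obtain ⟨x, hx⟩ := h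
  intro h
  have : (1 : MvPolynomial (Fin K) ℂ) ∈ vIdeal X := by rw [h]; trivial
  have := this x hx
  simp at this

lemma coneDim_spec {K : ℕ} {X : Set (Fin K → ℂ)} (h : X.Nonempty) :
    ringKrullDim (MvPolynomial (Fin K) ℂ ⧸ vIdeal X) = ((coneDim X : ℕ∞) : WithBot ℕ∞) := by
  have : Nontrivial (MvPolynomial (Fin K) ℂ ⧸ vIdeal X) :=
    Ideal.Quotient.nontrivial_iff.2 (vIdeal_ne_top h)
  have h0 := ringKrullDim_nonneg_of_nontrivial (R := MvPolynomial (Fin K) ℂ ⧸ vIdeal X)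
  have h1 := ringKrullDim_quotient_le (vIdeal X)
  rw [MvPolynomial.ringKrullDim_of_isNoetherianRing, ringKrullDim_eq_zero_of_field] at h1
  unfold coneDim
  generalize ringKrullDim (MvPolynomial (Fin K) ℂ ⧸ vIdeal X) = D at *
  induction D with
  | bot => simp at h0
  | coe D =>
    have : D ≠ ⊤ := by
      rintro rfl
      rw [zero_add] at h1
      have h2 : (⊤ : ℕ∞) ≤ ((Nat.card (Fin K) : ℕ) : ℕ∞) := by exact_mod_cast h1
      exact (ENat.natCast_ne_top _) (top_le_iff.1 h2)
    simp [ENat.natCast_toNat this]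

lemma coneDim_le_iff {K : ℕ} {X : Set (Fin K → ℂ)} (h : X.Nonempty) (d : ℕ) :
    coneDim X ≤ d ↔
      ringKrullDim (MvPolynomial (Fin K) ℂ ⧸ vIdeal X) ≤ ((d : ℕ∞) : WithBot ℕ∞) := by
  rw [coneDim_spec h]; norm_cast

lemma coneDim_mono {K : ℕ} {X Y : Set (Fin K → ℂ)} (hX : X.Nonempty) (h : X ⊆ Y) :
    coneDim X ≤ coneDim Y := by
  rw [coneDim_le_iff hX, ← coneDim_spec (hX.mono h)]
  exact ringKrullDim_le_of_surjective (Ideal.Quotient.factor (vIdeal_anti h))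
    (Ideal.Quotient.factor_surjective _)

lemma eq_zero_of_coneDim {K : ℕ} {X : Set (Fin K → ℂ)} (hX : IsCone X) (h : coneDim X = 0)
    {x : Fin K → ℂ} (hx : x ∈ X) : x = 0 := by
  by_contra hne
  obtain ⟨i, hi⟩ := Function.ne_iff.1 hne
  have h1 := (coneDim_le_iff ⟨x, hx⟩ 0).1 h.le
  let f : MvPolynomial (Fin K) ℂ ⧸ vIdeal X →+* Polynomial ℂ :=
    Ideal.Quotient.lift _ (lineMap x).toRingHom (fun p hp => lineMap_eq_zero hX hx hp)
  have hs : Function.Surjective f := by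
    apply Ideal.Quotient.lift_surjective_of_surjective
    change Function.Surjective (lineMap x)
    rw [← AlgHom.range_eq_top, ← top_le_iff, ← Polynomial.adjoin_X, Algebra.adjoin_le_iff]
    rintro _ rfl
    refine ⟨MvPolynomial.C (x i)⁻¹ * MvPolynomial.X i, ?_⟩
    have : x i ≠ 0 := hi
    simp only [AlgHom.toRingHom_eq_coe, RingHom.coe_coe, lineMap, map_mul, MvPolynomial.aeval_X,
      MvPolynomial.aeval_C]
    change Polynomial.C (x i)⁻¹ * _ = _
    rw [← mul_assoc, ← Polynomial.C_mul, inv_mul_cancel₀ this, Polynomial.C_1, one_mul]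
  have h2 := (ringKrullDim_le_of_surjective f hs).trans h1
  rw [Polynomial.ringKrullDim_of_isNoetherianRing, ringKrullDim_eq_zero_of_field] at h2
  norm_num at h2


/-- linear form with coefficients `a` -/
def linForm {K : ℕ} : (Fin K → ℂ) →ₗ[ℂ] MvPolynomial (Fin K) ℂ :=
  Fintype.linearCombination ℂ (fun i => (MvPolynomial.X i : MvPolynomial (Fin K) ℂ))

lemma linForm_homog {K : ℕ} (a : Fin K → ℂ) : (linForm a).IsHomogeneous 1 := by
  rw [linForm, Fintype.linearCombination_apply]
  refine MvPolynomial.IsHomogeneous.sum _ _ _ fun i _ => ?_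
  rw [MvPolynomial.smul_eq_C_mul]
  simpa using (MvPolynomial.isHomogeneous_C (Fin K) (a i)).mul (MvPolynomial.isHomogeneous_X ℂ i)

lemma linForm_single {K : ℕ} (i : Fin K) : linForm (Pi.single i 1) = MvPolynomial.X i := by
  simp [linForm, Fintype.linearCombination_apply_single]

lemma exists_linForm {K : ℕ} (J : Ideal (MvPolynomial (Fin K) ℂ)) :
    ∃ a : Fin K → ℂ, ∀ p ∈ J.minimalPrimes, linForm a ∈ p → ∀ i, MvPolynomial.X i ∈ p := by
  classical
  have hfin := Ideal.finite_minimalPrimes_of_isNoetherianRing _ J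
  let L : Ideal (MvPolynomial (Fin K) ℂ) → Subspace ℂ (Fin K → ℂ) := fun p =>
    (p.restrictScalars ℂ).comap linForm
  let s : Finset (Subspace ℂ (Fin K → ℂ)) := (hfin.toFinset.image L).erase ⊤
  have h := Subspace.biUnion_ne_univ_of_top_notMem (s := s) (by simp [s])
  obtain ⟨a, ha⟩ := (Set.ne_univ_iff_exists_notMem _).1 h
  refine ⟨a, fun p hp hap i => ?_⟩
  have htop : L p = ⊤ := by
    by_contra hne
    apply ha
    simp only [Set.mem_iUnion]
    exact ⟨L p, Finset.mem_erase.2 ⟨hne, Finset.mem_image.2 ⟨p, hfin.mem_toFinset.2 hp, rfl⟩⟩, hap⟩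
  have : (Pi.single i 1 : Fin K → ℂ) ∈ L p := by rw [htop]; trivial
  have h3 : linForm (Pi.single i 1 : Fin K → ℂ) ∈ p := this
  rwa [linForm_single] at h3

lemma isMaximal_of_vars {K : ℕ} (p : Ideal (MvPolynomial (Fin K) ℂ)) (hp : p ≠ ⊤)
    (h : ∀ i, MvPolynomial.X i ∈ p) : p.IsMaximal := by
  have hle : MvPolynomial.vanishingIdeal ℂ {(0 : Fin K → ℂ)} ≤ p := by
    intro f hf
    have hf0 : MvPolynomial.coeff 0 f = 0 := by
      have := (MvPolynomial.mem_vanishingIdeal_singleton_iff _ _).1 hf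
      rw [← MvPolynomial.constantCoeff_eq]
      simpa using this
    have : f ∈ MvPolynomial.idealOfVars (Fin K) ℂ ^ 1 := by
      rw [MvPolynomial.mem_pow_idealOfVars_iff']
      intro x hx
      have : x = 0 := by
        rw [← Finsupp.degree_eq_zero_iff]; omega
      rw [this, hf0]
    rw [pow_one] at this
    exact (Ideal.span_le.2 (by rintro _ ⟨i, rfl⟩; exact h i)) this
  have hm : (MvPolynomial.vanishingIdeal ℂ {(0 : Fin K → ℂ)}).IsMaximal := inferInstance
  rwa [← hm.eq_of_le hp hle]

lemma dim_cut {K : ℕ} (X : Set (Fin K → ℂ)) (hX : X.Nonempty) (a : Fin K → ℂ)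
    (ha : ∀ p ∈ (vIdeal X).minimalPrimes, linForm a ∈ p → ∀ i, MvPolynomial.X i ∈ p)
    (h0 : (X ∩ hypCone (linForm a)).Nonempty) (d : ℕ) (hd : coneDim X ≤ d + 1) :
    coneDim (X ∩ hypCone (linForm a)) ≤ d := by
  rw [coneDim_le_iff hX, ringKrullDim_quotient] at hd
  rw [coneDim_le_iff h0, ringKrullDim_quotient]
  refine iSup_le fun s => ?_
  have hsub : ∀ p : PrimeSpectrum (MvPolynomial (Fin K) ℂ),
      p ∈ PrimeSpectrum.zeroLocus (R := MvPolynomial (Fin K) ℂ)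
        (vIdeal (X ∩ hypCone (linForm a))) →
      p ∈ PrimeSpectrum.zeroLocus (R := MvPolynomial (Fin K) ℂ) (vIdeal X) := fun p hp =>
    Set.Subset.trans (vIdeal_anti Set.inter_subset_left) hp
  have hl : linForm a ∈ s.head.1.asIdeal := s.head.2 (fun x hx => hx.2)
  have := s.head.1.2
  obtain ⟨q, hq, hqle⟩ := Ideal.exists_minimalPrimes_le (I := vIdeal X) (J := s.head.1.asIdeal)
    (hsub _ s.head.2)
  by_cases hlq : linForm a ∈ q
  · have hmax : s.head.1.asIdeal.IsMaximal :=
      isMaximal_of_vars _ s.head.1.2.ne_top (fun i => hqle (ha q hq hlq i))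
    have : s.length = 0 := by
      by_contra hne
      have : NeZero s.length := ⟨hne⟩
      have h1 : s.head < s.last := LTSeries.strictMono s (show (0 : Fin (s.length + 1)) < Fin.last _ from by
        rw [Fin.lt_def]; simp; omega)
      have h2 : s.head.1.asIdeal < s.last.1.asIdeal := h1
      exact s.last.1.2.ne_top (hmax.1.2 _ h2)
    rw [this]
    exact_mod_cast Nat.zero_le d
  · let t : LTSeries (PrimeSpectrum.zeroLocus (R := MvPolynomial (Fin K) ℂ) (vIdeal X)) :=
      s.map (fun p => ⟨p.1, hsub p.1 p.2⟩) (fun p p' h => h)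
    let q' : PrimeSpectrum.zeroLocus (R := MvPolynomial (Fin K) ℂ) (vIdeal X) :=
      ⟨⟨q, hq.1.1⟩, hq.1.2⟩
    have hlt : q' < t.head := by
      change q < s.head.1.asIdeal
      exact lt_of_le_of_ne hqle (fun h => hlq (h ▸ hl))
    have h1 := (Order.LTSeries.length_le_krullDim (t.cons q' hlt)).trans hd
    have h2 : (t.cons q' hlt).length = s.length + 1 := by
      rw [RelSeries.cons_length]; rfl
    rw [h2] at h1
    have h3 : s.length + 1 ≤ d + 1 := by exact_mod_cast h1
    have h4 : s.length ≤ d := by omega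
    exact_mod_cast h4

lemma isCone_inter {K : ℕ} {X : Set (Fin K → ℂ)} (hX : IsCone X) {p : MvPolynomial (Fin K) ℂ}
    {m : ℕ} (hp : p.IsHomogeneous m) : IsCone (X ∩ hypCone p) := by
  intro t x hx
  refine ⟨hX t x hx.1, ?_⟩
  have h : MvPolynomial.eval x p = 0 := hx.2
  change MvPolynomial.eval (t • x) p = 0
  rw [eval_smul_homog x t hp, h, zero_mul]

lemma zero_mem_inter {K : ℕ} {X : Set (Fin K → ℂ)} (hX : 0 ∈ X) {p : MvPolynomial (Fin K) ℂ}
    {m : ℕ} (hm : 1 ≤ m) (hp : p.IsHomogeneous m) : 0 ∈ X ∩ hypCone p := by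
  refine ⟨hX, ?_⟩
  have := eval_smul_homog (0 : Fin K → ℂ) 0 hp
  rw [smul_zero, zero_pow (by omega), mul_zero] at this
  exact this

lemma exists_linForms {K : ℕ} (d : ℕ) : ∀ X : Set (Fin K → ℂ), IsCone X → 0 ∈ X →
    coneDim X ≤ d → ∃ f : Fin d → MvPolynomial (Fin K) ℂ,
      (∀ k, (f k).IsHomogeneous 1) ∧
      ∀ x ∈ X, (∀ k, MvPolynomial.eval x (f k) = 0) → x = 0 := by
  induction d with
  | zero =>
    intro X hX h0 hd
    exact ⟨fun k => 0, fun k => k.elim0, fun x hx _ => eq_zero_of_coneDim hX (by omega) hx⟩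
  | succ d ih =>
    intro X hX h0 hd
    obtain ⟨a, ha⟩ := exists_linForm (vIdeal X)
    have h0' := zero_mem_inter h0 le_rfl (linForm_homog a)
    obtain ⟨f, hf, hf'⟩ := ih _ (isCone_inter hX (linForm_homog a)) h0'
      (dim_cut X ⟨0, h0⟩ a ha ⟨0, h0'⟩ d hd)
    refine ⟨Fin.cons (linForm a) f, ?_, ?_⟩
    · intro k
      refine Fin.cases ?_ (fun k => ?_) k
      · simpa using linForm_homog a
      · simpa using hf k
    · intro x hx hk
      refine hf' x ⟨hx, ?_⟩ (fun k => ?_)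
      · exact hk 0
      · simpa using hk k.succ

lemma ringKrullDim_le_of_integral {R S : Type*} [CommRing R] [CommRing S] [Algebra R S]
    [Algebra.IsIntegral R S] : ringKrullDim S ≤ ringKrullDim R := by
  refine Order.krullDim_le_of_strictMono (PrimeSpectrum.comap (algebraMap R S)) ?_
  intro p q h
  have := p.2
  exact Ideal.IsIntegral.comap_lt_comap (R := R) (I := p.asIdeal) (J := q.asIdeal) h

lemma dim_le_of_forms_aux {K r : ℕ} {S : Type*} [CommRing S]
    (π : MvPolynomial (Fin K) ℂ →+* S) (hπ : Function.Surjective π)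
    [Algebra (MvPolynomial (Fin r) ℂ) S]
    (f : Fin r → MvPolynomial (Fin K) ℂ) (e : Fin r → ℕ)
    (hsmul : ∀ (a : MvPolynomial (Fin r) ℂ) (p : MvPolynomial (Fin K) ℂ),
      a • (π p) = π (MvPolynomial.aeval f a * p))
    (he : ∀ k, 1 ≤ e k) (hf : ∀ k, (f k).IsHomogeneous (e k))
    (hhom : ∀ p, π p = 0 → ∀ m, π (MvPolynomial.homogeneousComponent m p) = 0)
    (N : ℕ) (hN : MvPolynomial.idealOfVars (Fin K) ℂ ^ N ≤
      RingHom.ker π ⊔ Ideal.span (Set.range f)) :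
    ringKrullDim S ≤ ((r : ℕ∞) : WithBot ℕ∞) := by
  classical
  let B : Set S :=
    (fun s => π (MvPolynomial.monomial s 1)) '' {s : Fin K →₀ ℕ | s.degree < N}
  have hB : B.Finite := (Finsupp.finite_of_degree_lt N).image _
  let W := Submodule.span (MvPolynomial (Fin r) ℂ) B
  have key : ∀ m, ∀ p : MvPolynomial (Fin K) ℂ, p.IsHomogeneous m →
      π p ∈ W := by
    intro m
    induction m using Nat.strong_induction_on with
    | _ m ih =>
    intro p hp
    have hdeg : ∀ s ∈ p.support, s.degree = m := by
      intro s hs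
      have := hp (MvPolynomial.mem_support_iff.1 hs)
      rw [Finsupp.degree_eq_weight_one]; exact this
    by_cases hm : m < N
    · rw [p.as_sum, map_sum]
      refine Submodule.sum_mem _ fun s hs => ?_
      have h1 : π (MvPolynomial.monomial s (p.coeff s)) =
          (MvPolynomial.C (p.coeff s) : MvPolynomial (Fin r) ℂ) •
            π (MvPolynomial.monomial s 1) := by
        rw [hsmul]
        congr 1
        rw [MvPolynomial.aeval_C, MvPolynomial.algebraMap_eq, MvPolynomial.C_mul_monomial, mul_one]
      rw [h1]
      exact Submodule.smul_mem _ _ (Submodule.subset_span ⟨s, by simp [hdeg s hs, hm], rfl⟩)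
    · have hpT : p ∈ RingHom.ker π ⊔ Ideal.span (Set.range f) := by
        apply hN
        rw [MvPolynomial.mem_pow_idealOfVars_iff']
        intro s hs
        by_contra hne
        have := hdeg s (MvPolynomial.mem_support_iff.2 hne)
        omega
      obtain ⟨j, hj, g, hg, hjg⟩ := Submodule.mem_sup.1 hpT
      obtain ⟨c, hc⟩ := (Ideal.mem_span_range_iff_exists_fun).1 hg
      have hpm : p = MvPolynomial.homogeneousComponent m j +
          ∑ k, MvPolynomial.homogeneousComponent m (c k * f k) := by
        rw [← map_sum, hc, ← map_add, hjg, MvPolynomial.homogeneousComponent_eq_self hp]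
      rw [hpm, map_add, hhom j hj m, zero_add, map_sum]
      refine Submodule.sum_mem _ fun k _ => ?_
      rw [← MvPolynomial.sum_homogeneousComponent (c k), Finset.sum_mul, map_sum, map_sum]
      refine Submodule.sum_mem _ fun l _ => ?_
      have hh := (MvPolynomial.homogeneousComponent_isHomogeneous l (c k)).mul (hf k)
      rw [MvPolynomial.homogeneousComponent_of_mem hh]
      split_ifs with hml
      · have h1 := ih l (by have := he k; omega) _
          (MvPolynomial.homogeneousComponent_isHomogeneous l (c k))
        have h2 := Submodule.smul_mem W (MvPolynomial.X k) h1
        rw [hsmul, MvPolynomial.aeval_X, mul_comm] at h2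
        exact h2
      · simp
  have hW : W = ⊤ := by
    rw [← top_le_iff]
    rintro y -
    obtain ⟨p, rfl⟩ := hπ y
    rw [← MvPolynomial.sum_homogeneousComponent p, map_sum]
    exact Submodule.sum_mem _ fun l _ =>
      key l _ (MvPolynomial.homogeneousComponent_isHomogeneous l p)
  have : Module.Finite (MvPolynomial (Fin r) ℂ) S :=
    ⟨⟨hB.toFinset, by rw [Set.Finite.coe_toFinset]; exact hW⟩⟩
  have h1 := ringKrullDim_le_of_integral (R := MvPolynomial (Fin r) ℂ)
    (S := S)
  rw [MvPolynomial.ringKrullDim_of_isNoetherianRing, ringKrullDim_eq_zero_of_field, zero_add,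
    Nat.card_fin] at h1
  exact h1

lemma coneDim_le_of_forms {K r : ℕ} {X : Set (Fin K → ℂ)} (hX : IsCone X) (h0 : 0 ∈ X)
    (hA : coneOf (vIdeal X) ⊆ X) (f : Fin r → MvPolynomial (Fin K) ℂ) (e : Fin r → ℕ)
    (he : ∀ k, 1 ≤ e k) (hf : ∀ k, (f k).IsHomogeneous (e k))
    (hz : ∀ x ∈ X, (∀ k, MvPolynomial.eval x (f k) = 0) → x = 0) : coneDim X ≤ r := by
  classical
  rw [coneDim_le_iff ⟨0, h0⟩]
  set J := vIdeal X with hJ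
  let T : Ideal (MvPolynomial (Fin K) ℂ) := J ⊔ Ideal.span (Set.range f)
  have hrad : MvPolynomial.idealOfVars (Fin K) ℂ ≤ T.radical := by
    rw [← MvPolynomial.vanishingIdeal_zeroLocus_eq_radical (K := ℂ)]
    refine Ideal.span_le.2 ?_
    rintro _ ⟨i, rfl⟩ x hx
    have hx' : ∀ p ∈ T, MvPolynomial.eval x p = 0 := fun p hp => hx p hp
    have hx0 : x = 0 := hz x (hA (fun p hp => hx' p (Ideal.mem_sup_left hp)))
      (fun k => hx' _ (Ideal.mem_sup_right (Ideal.subset_span ⟨k, rfl⟩)))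
    simp [hx0]
  obtain ⟨N, hN⟩ := Ideal.exists_pow_le_of_le_radical_of_fg hrad
    (MvPolynomial.idealOfVars_fg (Fin K) ℂ)
  let φ : MvPolynomial (Fin r) ℂ →+* (MvPolynomial (Fin K) ℂ ⧸ J) :=
    (Ideal.Quotient.mk J).comp (MvPolynomial.aeval f).toRingHom
  let _ : Algebra (MvPolynomial (Fin r) ℂ) (MvPolynomial (Fin K) ℂ ⧸ J) := φ.toAlgebra
  refine dim_le_of_forms_aux (Ideal.Quotient.mk J) Ideal.Quotient.mk_surjective f e ?_ he hf
    ?_ N ?_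
  · intro a p
    rw [Algebra.smul_def, map_mul]; rfl
  · intro p hp m
    rw [Ideal.Quotient.eq_zero_iff_mem] at hp ⊢
    exact vIdeal_homog hX hp m
  · rw [Ideal.mk_ker]; exact hN

lemma coneDim_le_succ {K : ℕ} {X : Set (Fin K → ℂ)} (hX : IsCone X) (h0 : 0 ∈ X)
    (hA : coneOf (vIdeal X) ⊆ X) {p : MvPolynomial (Fin K) ℂ} {m : ℕ} (hm : 1 ≤ m)
    (hp : p.IsHomogeneous m) : coneDim X ≤ coneDim (X ∩ hypCone p) + 1 := by
  obtain ⟨f, hf, hf'⟩ := exists_linForms _ _ (isCone_inter hX hp) (zero_mem_inter h0 hm hp) le_rfl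
  refine coneDim_le_of_forms hX h0 hA (Fin.cons p f) (Fin.cons m fun _ => 1) ?_ ?_ ?_
  · intro k
    refine Fin.cases ?_ (fun k => ?_) k <;> simp [hm]
  · intro k
    refine Fin.cases ?_ (fun k => ?_) k
    · simpa using hp
    · simpa using hf k
  · intro x hx hk
    refine hf' x ⟨hx, ?_⟩ (fun k => ?_)
    · exact hk 0
    · simpa using hk k.succ


lemma vIdeal_coneOf {K : ℕ} (I : Ideal (MvPolynomial (Fin K) ℂ)) [I.IsPrime] :
    vIdeal (coneOf I) = I := by
  have h := MvPolynomial.IsPrime.vanishingIdeal_zeroLocus (K := ℂ) I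
  ext p
  conv_rhs => rw [← h]
  rfl

lemma isCone_coneOf {K n : ℕ} {I : Ideal (MvPolynomial (Fin K) ℂ)} (hI : IsVariety n I) :
    IsCone (coneOf I) := by
  obtain ⟨-, ⟨S, hS, hIS⟩, -⟩ := hI
  intro t x hx
  have hle : I ≤ vIdeal {t • x} := by
    rw [hIS, Ideal.span_le]
    intro p hp y hy
    obtain ⟨e, he⟩ := hS p hp
    rw [Set.mem_singleton_iff.1 hy, eval_smul_homog x t he,
      hx p (by rw [hIS]; exact Ideal.subset_span hp), zero_mul]
  exact fun p hp => hle hp _ rfl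

lemma zero_mem_coneOf {K n : ℕ} {I : Ideal (MvPolynomial (Fin K) ℂ)} (hI : IsVariety n I) :
    0 ∈ coneOf I := by
  have hp := hI.1
  have hne : (coneOf I).Nonempty := by
    by_contra h
    rw [Set.not_nonempty_iff_eq_empty] at h
    apply hp.ne_top
    rw [← vIdeal_coneOf I, h, Ideal.eq_top_iff_one]
    intro x hx
    exact hx.elim
  obtain ⟨x, hx⟩ := hne
  simpa using isCone_coneOf hI 0 x hx

section
variable {K n q : ℕ} {I : Ideal (MvPolynomial (Fin K) ℂ)} {Q : Fin q → MvPolynomial (Fin K) ℂ}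
  {d : Fin q → ℕ}

lemma interCone_empty : interCone I Q ∅ = coneOf I := by simp [interCone]

lemma interCone_insert (i : Fin q) (R : Finset (Fin q)) :
    interCone I Q (insert i R) = interCone I Q R ∩ hypCone (Q i) := by
  rw [interCone, interCone, Finset.set_biInter_insert, Set.inter_assoc,
    Set.inter_comm (hypCone (Q i))]

lemma interCone_anti {R R' : Finset (Fin q)} (h : R ⊆ R') :
    interCone I Q R' ⊆ interCone I Q R :=
  Set.inter_subset_inter_right _ (Set.biInter_subset_biInter_left h)

lemma isCone_interCone (hI : IsVariety n I) (hQ : ∀ j, (Q j).IsHomogeneous (d j))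
    (R : Finset (Fin q)) : IsCone (interCone I Q R) := by
  induction R using Finset.induction_on with
  | empty => rw [interCone_empty]; exact isCone_coneOf hI
  | insert i R _ ih => rw [interCone_insert]; exact isCone_inter ih (hQ i)

lemma zero_mem_interCone (hI : IsVariety n I) (hd : ∀ j, 1 ≤ d j)
    (hQ : ∀ j, (Q j).IsHomogeneous (d j)) (R : Finset (Fin q)) : 0 ∈ interCone I Q R := by
  induction R using Finset.induction_on with
  | empty => rw [interCone_empty]; exact zero_mem_coneOf hI
  | insert i R _ ih => rw [interCone_insert]; exact zero_mem_inter ih (hd i) (hQ i)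

lemma alg_interCone (R : Finset (Fin q)) :
    coneOf (vIdeal (interCone I Q R)) ⊆ interCone I Q R := by
  intro x hx
  refine ⟨fun p hp => hx p (fun y hy => hy.1 p hp), ?_⟩
  simp only [Set.mem_iInter]
  intro j hj
  refine hx (Q j) (fun y hy => ?_)
  have := hy.2
  simp only [Set.mem_iInter] at this
  exact this j hj

lemma dim_empty (hI : IsVariety n I) : coneDim (interCone I Q ∅) = n + 1 := by
  have hp := hI.1
  have h := coneDim_spec ⟨0, zero_mem_coneOf hI⟩
  rw [vIdeal_coneOf, hI.2.2] at h
  rw [interCone_empty]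
  exact_mod_cast h.symm

lemma dim_anti (hI : IsVariety n I) (hd : ∀ j, 1 ≤ d j)
    (hQ : ∀ j, (Q j).IsHomogeneous (d j)) {R R' : Finset (Fin q)} (h : R ⊆ R') :
    coneDim (interCone I Q R') ≤ coneDim (interCone I Q R) :=
  coneDim_mono ⟨0, zero_mem_interCone hI hd hQ R'⟩ (interCone_anti h)

lemma dim_insert (hI : IsVariety n I) (hd : ∀ j, 1 ≤ d j)
    (hQ : ∀ j, (Q j).IsHomogeneous (d j)) (i : Fin q) (R : Finset (Fin q)) :
    coneDim (interCone I Q R) ≤ coneDim (interCone I Q (insert i R)) + 1 := by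
  rw [interCone_insert]
  exact coneDim_le_succ (isCone_interCone hI hQ R) (zero_mem_interCone hI hd hQ R)
    (alg_interCone R) (hd i) (hQ i)

lemma dim_union (hI : IsVariety n I) (hd : ∀ j, 1 ≤ d j)
    (hQ : ∀ j, (Q j).IsHomogeneous (d j)) (R L : Finset (Fin q)) :
    coneDim (interCone I Q R) ≤ coneDim (interCone I Q (L ∪ R)) + L.card := by
  induction L using Finset.induction_on with
  | empty => simp
  | insert i L hi ih =>
    rw [Finset.insert_union, Finset.card_insert_of_notMem hi]
    have := dim_insert hI hd hQ i (L ∪ R)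
    omega

lemma genPos_of_card (hI : IsVariety n I) (hd : ∀ j, 1 ≤ d j)
    (hQ : ∀ j, (Q j).IsHomogeneous (d j)) {R : Finset (Fin q)}
    (hR : R.card + coneDim (interCone I Q R) = n + 1) : GenPos n I Q R := by
  intro J hJ _ _
  have h1 := dim_union hI hd hQ J (R \ J)
  rw [Finset.sdiff_union_of_subset hJ, Finset.card_sdiff_of_subset hJ] at h1
  have h2 := Finset.card_le_card hJ
  obtain ⟨f, hf, hf'⟩ := exists_linForms (n + 1 - J.card) _ (isCone_interCone hI hQ J)
    (zero_mem_interCone hI hd hQ J) (by omega)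
  exact ⟨f, fun k => ⟨1, le_rfl, hf k⟩, hf'⟩

lemma exists_drop (hI : IsVariety n I) (hd : ∀ j, 1 ≤ d j)
    (hQ : ∀ j, (Q j).IsHomogeneous (d j)) {N : ℕ} (hsub : InSubgenPos n N I Q)
    {L R : Finset (Fin q)} (hLR : L ⊆ R) (hL : L.card + coneDim (interCone I Q L) = n + 1)
    (hlt : coneDim (interCone I Q R) < coneDim (interCone I Q L)) :
    ∃ i ∈ R, i ∉ L ∧ coneDim (interCone I Q (insert i L)) < coneDim (interCone I Q L) := by
  by_contra! hcon
  have heq : ∀ i ∈ R, i ∉ L →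
      coneDim (interCone I Q (insert i L)) = coneDim (interCone I Q L) := fun i hi hiL =>
    le_antisymm (dim_anti hI hd hQ (Finset.subset_insert i L)) (hcon i hi hiL)
  have hp := hI.1
  -- an irreducible set of full dimension inside all the hypersurfaces
  have hσ : ∃ σ : Set (Fin K → ℂ), σ.Nonempty ∧ σ ⊆ interCone I Q L ∧
      coneDim σ = coneDim (interCone I Q L) ∧ ∀ i ∈ R, i ∉ L → σ ⊆ hypCone (Q i) := by
    rcases L.eq_empty_or_nonempty with rfl | hne
    · refine ⟨coneOf I, ⟨0, zero_mem_coneOf hI⟩, by rw [interCone_empty], by rw [interCone_empty],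
        fun i hi hiL => ?_⟩
      exfalso
      have hi1 := heq i hi hiL
      rw [dim_empty hI] at hi1
      obtain ⟨x, hx, hxi⟩ := Set.not_subset.1 (hsub.1 i)
      have hiI : Q i ∉ I := fun h => hxi (hx _ h)
      have hs : I ≤ vIdeal (interCone I Q (insert i ∅)) := fun p hp y hy => hy.1 p hp
      have hz : Q i ∈ vIdeal (interCone I Q (insert i ∅)) := by
        intro y hy
        rw [interCone_insert] at hy
        exact hy.2
      have h1 := ringKrullDim_succ_le_of_surjective (Ideal.Quotient.factor hs)
        (Ideal.Quotient.factor_surjective hs) (r := Ideal.Quotient.mk I (Q i))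
        (mem_nonZeroDivisors_of_ne_zero (by rwa [Ne, Ideal.Quotient.eq_zero_iff_mem]))
        (by rw [Ideal.Quotient.factor_mk, Ideal.Quotient.eq_zero_iff_mem]; exact hz)
      rw [hI.2.2, coneDim_spec ⟨0, zero_mem_interCone hI hd hQ _⟩, hi1] at h1
      have h2 : n + 1 + 1 ≤ n + 1 := by exact_mod_cast h1
      omega
    · obtain ⟨σ, hσ, hdim, hall⟩ := hsub.2.2 L hne.card_pos (by omega)
        (genPos_of_card hI hd hQ hL) (by
          by_contra! h0
          have := coneDim_le_of_forms (r := 0) (isCone_interCone hI hQ L)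
            (zero_mem_interCone hI hd hQ L) (alg_interCone L) (fun k => k.elim0) (fun k => k.elim0)
            (fun k => k.elim0) (fun k => k.elim0) (fun x hx _ => h0 x hx)
          omega)
      refine ⟨σ, ?_, hσ.1, hdim, fun i hi hiL => hall i hiL (heq i hi hiL)⟩
      by_contra h
      rw [Set.not_nonempty_iff_eq_empty] at h
      apply hσ.2.2.1.ne_top
      rw [h, Ideal.eq_top_iff_one]
      intro x hx
      exact hx.elim
  obtain ⟨σ, hne, hsubσ, hdim, hall⟩ := hσ
  have hle : σ ⊆ interCone I Q R := by
    intro x hx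
    refine ⟨(hsubσ hx).1, ?_⟩
    simp only [Set.mem_iInter]
    intro j hj
    by_cases hjL : j ∈ L
    · have := (hsubσ hx).2
      simp only [Set.mem_iInter] at this
      exact this j hjL
    · exact hall j hj hjL hx
  have := coneDim_mono hne hle
  omega

lemma extend_aux (hI : IsVariety n I) (hd : ∀ j, 1 ≤ d j)
    (hQ : ∀ j, (Q j).IsHomogeneous (d j)) {N : ℕ} (hsub : InSubgenPos n N I Q)
    (R : Finset (Fin q)) (m : ℕ) : ∀ L : Finset (Fin q), L ⊆ R →
    L.card + coneDim (interCone I Q L) = n + 1 →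
    coneDim (interCone I Q L) = coneDim (interCone I Q R) + m →
    ∃ L' : Finset (Fin q), L ⊆ L' ∧ L' ⊆ R ∧ L'.card + coneDim (interCone I Q L') = n + 1 ∧
      coneDim (interCone I Q L') = coneDim (interCone I Q R) := by
  induction m with
  | zero => intro L h1 h2 h3; exact ⟨L, subset_rfl, h1, h2, h3⟩
  | succ m ih =>
    intro L h1 h2 h3
    obtain ⟨i, hiR, hiL, hlt⟩ := exists_drop hI hd hQ hsub h1 h2 (by omega)
    have h4 := dim_insert hI hd hQ i L
    obtain ⟨L', g1, g2, g3⟩ := ih (insert i L) (Finset.insert_subset hiR h1)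
      (by rw [Finset.card_insert_of_notMem hiL]; omega) (by omega)
    exact ⟨L', (Finset.subset_insert i L).trans g1, g2, g3⟩

end

/-- **Lemma 2.2.** If `K ⊆ R ⊆ Q` and `#K = c(K)`, then there is `K'` with
`K ⊆ K' ⊆ R` and `c(K') = #K' = c(R)`. -/
theorem statement8 {M n N q : ℕ} (hn : 1 ≤ n) (hNn : n ≤ N) (hq : N + 1 ≤ q)
    (I : Ideal (MvPolynomial (Fin (M + 1)) ℂ)) (hV : IsSmoothVariety n I)
    (Q : Fin q → MvPolynomial (Fin (M + 1)) ℂ) (d : Fin q → ℕ)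
    (hd : ∀ j, 1 ≤ d j) (hQ : ∀ j, (Q j).IsHomogeneous (d j))
    (hsub : InSubgenPos n N I Q) :
    ∀ K R : Finset (Fin q), K ⊆ R → K.card = cdim n I Q K →
      ∃ K' : Finset (Fin q), K ⊆ K' ∧ K' ⊆ R ∧
        cdim n I Q K' = K'.card ∧ K'.card = cdim n I Q R := by
  intro K R hKR hK
  have hI := hV.1
  have h0 : ∀ L, coneDim (interCone I Q L) ≤ n + 1 := fun L => by
    have := dim_anti hI hd hQ (Finset.empty_subset L)
    rwa [dim_empty hI] at this
  unfold cdim at hK ⊢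
  have hK0 := h0 K
  have hle := dim_anti hI hd hQ hKR
  obtain ⟨L, g1, g2, g3, g4⟩ := extend_aux hI hd hQ hsub R
    (coneDim (interCone I Q K) - coneDim (interCone I Q R)) K hKR (by omega) (by omega)
  exact ⟨L, g1, g2, by omega, by omega⟩

end SMT
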